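/- arXiv:2008.13619 — 2 statements merged into one kernel-verified Lean document; each statement's English description precedes it below -/
import Mathlib

section
/- (Proposition 3, unbiasedness of the between-laboratory variance estimate.) Let a, b > 0 be real numbers, let n ≥ 2 and L ≥ 2 be natural numbers, and let X₁,…,X_L be independent random variables each distributed according to the beta-binomial distribution BBi(n,a,b). With p̂ᵢ = Xᵢ/n, σ̂_r² = (n/(L(n−1)))·Σᵢ p̂ᵢ(1−p̂ᵢ), and σ̂_BBi² = (1/(L−1))·Σᵢ (Xᵢ − X̄)² where X̄ = (1/L)Σᵢ Xᵢ, the estimator σ̂_L² = (σ̂_BBi² − n·σ̂_r²)/n² satisfies E[σ̂_L²] = a·b/((a+b)²(a+b+1)) = σ_L²; that is, σ̂_L² is an unbiased estimate of the between-laboratory variance. -/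
open MeasureTheory ProbabilityTheory

/-- The Beta function `B(a,b) = ∫₀¹ t^(a-1) (1-t)^(b-1) dt`. -/
noncomputable def betaFun (a b : ℝ) : ℝ :=
  ∫ t in (0:ℝ)..1, t ^ (a - 1) * (1 - t) ^ (b - 1)

/-- The probability mass function of the beta-binomial distribution `BBi(n,a,b)`:
`f(k) = C(n,k)·B(k+a, n-k+b)/B(a,b)` (which vanishes for `k > n`). -/
noncomputable def betaBinPMF (n : ℕ) (a b : ℝ) (k : ℕ) : ℝ :=
  (n.choose k : ℝ) * betaFun ((k : ℝ) + a) ((n : ℝ) - (k : ℝ) + b) / betaFun a b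

lemma betaFun_eq (a b : ℝ) (ha : 0 < a) (hb : 0 < b) : betaFun a b = beta a b := by
  rw [beta_eq_betaIntegralReal a b ha hb, Complex.betaIntegral, betaFun]
  have : ∀ t ∈ Set.uIcc (0:ℝ) 1, (t:ℂ) ^ ((a:ℂ) - 1) * (1 - (t:ℂ)) ^ ((b:ℂ) - 1)
      = ((t ^ (a - 1) * (1 - t) ^ (b - 1) : ℝ) : ℂ) := by
    intro t ht
    rw [Set.uIcc_of_le zero_le_one] at ht
    push_cast
    rw [Complex.ofReal_cpow ht.1, Complex.ofReal_cpow (by linarith [ht.2])]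
    push_cast
    rfl
  rw [intervalIntegral.integral_congr this, intervalIntegral.integral_ofReal, Complex.ofReal_re]

lemma beta_succ_left (a b : ℝ) (ha : 0 < a) (hb : 0 < b) :
    beta (a + 1) b = a / (a + b) * beta a b := by
  unfold beta
  rw [show a + 1 + b = (a + b) + 1 by ring, Real.Gamma_add_one ha.ne',
    Real.Gamma_add_one (by positivity)]
  have := Real.Gamma_pos_of_pos (add_pos ha hb)
  field_simp

lemma beta_succ_right (a b : ℝ) (ha : 0 < a) (hb : 0 < b) :
    beta a (b + 1) = b / (a + b) * beta a b := by
  unfold beta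
  rw [← add_assoc, Real.Gamma_add_one hb.ne',
    Real.Gamma_add_one (by positivity)]
  have := Real.Gamma_pos_of_pos (add_pos ha hb)
  field_simp

lemma beta_pascal (a b : ℝ) (ha : 0 < a) (hb : 0 < b) :
    beta (a + 1) b + beta a (b + 1) = beta a b := by
  rw [beta_succ_left a b ha hb, beta_succ_right a b ha hb]
  field_simp

/-- total mass -/
lemma sum_choose_beta (n : ℕ) : ∀ (a b : ℝ), 0 < a → 0 < b →
    ∑ k ∈ Finset.range (n + 1), (n.choose k : ℝ) * beta ((k : ℝ) + a) ((n : ℝ) - k + b)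
      = beta a b := by
  induction n with
  | zero => intro a b _ _; simp
  | succ n ih =>
    intro a b ha hb
    rw [Finset.sum_range_succ', ← beta_pascal a b ha hb, ← ih (a + 1) b (by positivity) hb,
      ← ih a (b + 1) ha (by positivity)]
    have h2 : ∑ k ∈ Finset.range (n + 1),
        (n.choose k : ℝ) * beta ((k : ℝ) + a) ((n : ℝ) - k + (b + 1))
        = ∑ k ∈ Finset.range (n + 1),
        (n.choose (k + 1) : ℝ) * beta ((k : ℝ) + (a + 1)) ((n : ℝ) - k + b)
        + beta a ((n : ℝ) + 1 + b) := by
      have := Finset.sum_range_succ (fun k : ℕ =>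
        (n.choose k : ℝ) * beta ((k : ℝ) + a) ((n : ℝ) - k + (b + 1))) (n + 1)
      rw [Finset.sum_range_succ'] at this
      simp only [Nat.choose_succ_self, Nat.cast_zero, zero_mul, add_zero] at this
      rw [← this]
      congr 1
      · apply Finset.sum_congr rfl
        intro k _
        push_cast
        congr 2 <;> ring
      · simp
        congr 1; ring
    rw [h2, ← add_assoc, ← Finset.sum_add_distrib]
    congr 1
    · apply Finset.sum_congr rfl
      intro k _
      rw [Nat.choose_succ_succ]
      push_cast
      rw [add_mul]
      congr 3 <;> ring
    · simp

lemma sum_choose_beta_one (n : ℕ) (a b : ℝ) (ha : 0 < a) (hb : 0 < b) :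
    ∑ k ∈ Finset.range (n + 2), (k : ℝ) *
      (((n + 1).choose k : ℝ) * beta ((k : ℝ) + a) (((n + 1 : ℕ) : ℝ) - k + b))
      = (n + 1) * beta (a + 1) b := by
  rw [Finset.sum_range_succ', ← sum_choose_beta n (a + 1) b (by positivity) hb, Finset.mul_sum]
  simp only [Nat.cast_zero, zero_mul, add_zero]
  apply Finset.sum_congr rfl
  intro k _
  have h : ((n : ℝ) + 1) * n.choose k = (n + 1).choose (k + 1) * (k + 1) := by
    exact_mod_cast Nat.add_one_mul_choose_eq n k
  rw [← mul_assoc, ← mul_assoc, h]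
  push_cast
  rw [mul_comm ((k : ℝ) + 1)]
  congr 2 <;> ring

lemma sum_choose_beta_two (n : ℕ) (a b : ℝ) (ha : 0 < a) (hb : 0 < b) :
    ∑ k ∈ Finset.range (n + 3), ((k : ℝ) * (k - 1)) *
      (((n + 2).choose k : ℝ) * beta ((k : ℝ) + a) (((n + 2 : ℕ) : ℝ) - k + b))
      = (n + 2) * ((n + 1) * beta (a + 1 + 1) b) := by
  rw [Finset.sum_range_succ', ← sum_choose_beta_one n (a + 1) b (by positivity) hb, Finset.mul_sum]
  simp only [Nat.cast_zero, zero_mul, add_zero]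
  apply Finset.sum_congr rfl
  intro k _
  have h : ((n : ℝ) + 2) * (n + 1).choose k = (n + 2).choose (k + 1) * (k + 1) := by
    exact_mod_cast Nat.add_one_mul_choose_eq (n + 1) k
  rw [show ((n : ℝ) + 2) * ((k : ℝ) * (((n + 1).choose k : ℝ) * beta ((k : ℝ) + (a + 1)) (((n + 1 : ℕ) : ℝ) - k + b))) = (k : ℝ) * (((n : ℝ) + 2) * (n + 1).choose k) * beta ((k : ℝ) + (a + 1)) (((n + 1 : ℕ) : ℝ) - k + b) by ring, h]
  rw [show (((k + 1 : ℕ) : ℝ) + a) = (k : ℝ) + (a + 1) by push_cast; ring,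
    show (((n + 2 : ℕ) : ℝ) - (k + 1 : ℕ) + b) = ((n + 1 : ℕ) : ℝ) - k + b by push_cast; ring]
  push_cast
  ring

lemma betaBinPMF_eq (n : ℕ) (a b : ℝ) (ha : 0 < a) (hb : 0 < b) (k : ℕ) (hk : k ≤ n) :
    betaBinPMF n a b k
      = ((n.choose k : ℝ) * beta ((k : ℝ) + a) ((n : ℝ) - k + b)) / beta a b := by
  have : (k : ℝ) ≤ n := by exact_mod_cast hk
  rw [betaBinPMF, betaFun_eq a b ha hb, betaFun_eq _ _ (by positivity) (by linarith)]

lemma pmf_moment_one (n : ℕ) (hn : 2 ≤ n) (a b : ℝ) (ha : 0 < a) (hb : 0 < b) :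
    ∑ k ∈ Finset.range (n + 1), (k : ℝ) * betaBinPMF n a b k = n * a / (a + b) := by
  obtain ⟨m, rfl⟩ : ∃ m, n = m + 1 := ⟨n - 1, by omega⟩
  have hB := beta_pos ha hb
  have h := sum_choose_beta_one m a b ha hb
  rw [beta_succ_left a b ha hb] at h
  rw [Finset.sum_congr rfl (fun k hk => by
    rw [betaBinPMF_eq (m + 1) a b ha hb k (by simpa [Nat.lt_succ_iff] using hk), mul_div_assoc']),
    ← Finset.sum_div, h]
  push_cast
  field_simp

lemma pmf_moment_two (n : ℕ) (hn : 2 ≤ n) (a b : ℝ) (ha : 0 < a) (hb : 0 < b) :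
    ∑ k ∈ Finset.range (n + 1), ((k : ℝ) * (k - 1)) * betaBinPMF n a b k
      = n * (n - 1) * (a * (a + 1)) / ((a + b) * (a + b + 1)) := by
  obtain ⟨m, rfl⟩ : ∃ m, n = m + 2 := ⟨n - 2, by omega⟩
  have hB := beta_pos ha hb
  have h := sum_choose_beta_two m a b ha hb
  rw [beta_succ_left (a + 1) b (by positivity) hb, beta_succ_left a b ha hb] at h
  rw [Finset.sum_congr rfl (fun k hk => by
    rw [betaBinPMF_eq (m + 2) a b ha hb k (by simpa [Nat.lt_succ_iff] using hk), mul_div_assoc']),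
    ← Finset.sum_div, h]
  push_cast
  have : a + 1 + b ≠ 0 := by positivity
  field_simp
  ring

lemma ae_le_of_dist {Ω : Type*} [MeasurableSpace Ω] (P : Measure Ω) [IsProbabilityMeasure P]
    (n : ℕ) (a b : ℝ) (Y : Ω → ℕ)
    (hd : ∀ k : ℕ, (P (Y ⁻¹' {k})).toReal = betaBinPMF n a b k) : ∀ᵐ ω ∂P, Y ω ≤ n := by
  have h : ∀ k : ℕ, ∀ᵐ ω ∂P, n < k → Y ω ≠ k := by
    intro k
    by_cases hk : n < k
    · have h0 : (P (Y ⁻¹' {k})).toReal = 0 := by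
        rw [hd k, betaBinPMF, Nat.choose_eq_zero_of_lt hk]; simp
      have h1 : P (Y ⁻¹' {k}) = 0 := by
        rcases (ENNReal.toReal_eq_zero_iff _).1 h0 with h | h
        · exact h
        · exact absurd h (measure_ne_top _ _)
      rw [measure_eq_zero_iff_ae_notMem] at h1
      filter_upwards [h1] with ω hω _ he
      exact hω he
    · exact Filter.Eventually.of_forall fun ω h => absurd h hk
  filter_upwards [ae_all_iff.2 h] with ω hω
  by_contra hc
  exact hω (Y ω) (by omega) rfl

lemma ae_expand {Ω : Type*} [MeasurableSpace Ω] (P : Measure Ω) [IsProbabilityMeasure P]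
    (n : ℕ) (a b : ℝ) (Y : Ω → ℕ)
    (hd : ∀ k : ℕ, (P (Y ⁻¹' {k})).toReal = betaBinPMF n a b k) (f : ℕ → ℝ) : (fun ω => f (Y ω)) =ᵐ[P]
    fun ω => ∑ k ∈ Finset.range (n + 1), (Y ⁻¹' {k}).indicator (fun _ => f k) ω := by
  filter_upwards [ae_le_of_dist P n a b Y hd] with ω hω
  rw [Finset.sum_eq_single (Y ω)]
  · simp
  · intro k _ hk
    exact Set.indicator_of_notMem (fun h => hk (by simpa using h.symm)) _
  · intro h
    exact absurd (Finset.mem_range.2 (by omega)) h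

lemma integrable_ind {Ω : Type*} [MeasurableSpace Ω] (P : Measure Ω) [IsProbabilityMeasure P]
    (Y : Ω → ℕ) (hY : Measurable Y) (f : ℕ → ℝ) (k : ℕ) :
    Integrable ((Y ⁻¹' {k}).indicator (fun _ => f k)) P :=
  (integrable_const (f k)).indicator (hY (measurableSet_singleton k))

lemma integrable_of_dist {Ω : Type*} [MeasurableSpace Ω] (P : Measure Ω) [IsProbabilityMeasure P]
    (n : ℕ) (a b : ℝ) (Y : Ω → ℕ) (hY : Measurable Y)
    (hd : ∀ k : ℕ, (P (Y ⁻¹' {k})).toReal = betaBinPMF n a b k) (f : ℕ → ℝ) : Integrable (fun ω => f (Y ω)) P := by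
  rw [integrable_congr (ae_expand P n a b Y hd f)]
  exact integrable_finsetSum _ fun k _ => integrable_ind P Y hY f k

lemma integral_of_dist {Ω : Type*} [MeasurableSpace Ω] (P : Measure Ω) [IsProbabilityMeasure P]
    (n : ℕ) (a b : ℝ) (Y : Ω → ℕ) (hY : Measurable Y)
    (hd : ∀ k : ℕ, (P (Y ⁻¹' {k})).toReal = betaBinPMF n a b k) (f : ℕ → ℝ) :
    ∫ ω, f (Y ω) ∂P = ∑ k ∈ Finset.range (n + 1), f k * betaBinPMF n a b k := by
  rw [integral_congr_ae (ae_expand P n a b Y hd f),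
    integral_finsetSum _ fun k _ => integrable_ind P Y hY f k]
  apply Finset.sum_congr rfl
  intro k _
  rw [integral_indicator_const _ (hY (measurableSet_singleton k)), measureReal_def, hd k,
    smul_eq_mul, mul_comm]


/-- Pure algebra: the integrand in terms of power sums. -/
lemma integrand_eq (L n : ℕ) (hn : 2 ≤ n) (hL : 2 ≤ L) (x : Fin L → ℝ) :
    ((1 / ((L : ℝ) - 1)) * ∑ i, (x i - (1 / (L : ℝ)) * ∑ j, x j) ^ 2
          - (n : ℝ) * (((n : ℝ) / ((L : ℝ) * ((n : ℝ) - 1)))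
              * ∑ i, (x i / (n : ℝ)) * (1 - x i / (n : ℝ)))) / (n : ℝ) ^ 2
      = (1 / (((L : ℝ) - 1) * n ^ 2) + 1 / (L * (n - 1) * n ^ 2)) * ∑ i, x i ^ 2
        - 1 / (L * (n - 1) * n) * ∑ i, x i
        - 1 / (L * ((L : ℝ) - 1) * n ^ 2) * ∑ i, ∑ j, x i * x j := by
  have hn' : (2 : ℝ) ≤ n := by exact_mod_cast hn
  have hL' : (2 : ℝ) ≤ L := by exact_mod_cast hL
  have h1 : (n : ℝ) - 1 ≠ 0 := by linarith
  have h2 : (L : ℝ) - 1 ≠ 0 := by linarith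
  have h3 : (n : ℝ) ≠ 0 := by linarith
  have h4 : (L : ℝ) ≠ 0 := by linarith
  rw [← Finset.sum_mul_sum]
  set S := ∑ j, x j with hS
  have e1 : ∑ i, (x i - (1 / (L : ℝ)) * S) ^ 2 = ∑ i, x i ^ 2 - S ^ 2 / L := by
    have : ∀ i, (x i - (1 / (L : ℝ)) * S) ^ 2
        = x i ^ 2 - x i * (2 * S / L) + (S / L) ^ 2 := fun i => by ring
    simp only [this]
    rw [Finset.sum_add_distrib, Finset.sum_sub_distrib, ← Finset.sum_mul, ← hS]
    simp
    field_simp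
    ring
  have e2 : ∑ i, (x i / (n : ℝ)) * (1 - x i / (n : ℝ)) = S / n - (∑ i, x i ^ 2) / n ^ 2 := by
    rw [hS, Finset.sum_div, Finset.sum_div, ← Finset.sum_sub_distrib]
    exact Finset.sum_congr rfl fun i _ => by ring
  rw [e1, e2]
  field_simp
  ring

/-- Proposition 3, unbiasedness of the between-laboratory variance estimate:
if `X₁,…,X_L` are independent, each distributed as `BBi(n,a,b)`, with
`p̂ᵢ = Xᵢ/n`, `σ̂_r² = (n/(L(n-1)))·∑ᵢ p̂ᵢ(1-p̂ᵢ)` and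
`σ̂_BBi² = (1/(L-1))·∑ᵢ (Xᵢ - X̄)²`, then `σ̂_L² = (σ̂_BBi² - n·σ̂_r²)/n²`
satisfies `E[σ̂_L²] = a·b/((a+b)²(a+b+1)) = σ_L²`. -/
theorem between_laboratory_estimate_unbiased {Ω : Type*} [MeasurableSpace Ω]
    (P : Measure Ω) [IsProbabilityMeasure P]
    (a b : ℝ) (ha : 0 < a) (hb : 0 < b)
    (n : ℕ) (hn : 2 ≤ n) (L : ℕ) (hL : 2 ≤ L)
    (X : Fin L → Ω → ℕ) (hX : ∀ i, Measurable (X i))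
    (hindep : iIndepFun X P)
    (hdist : ∀ i, ∀ k : ℕ, (P (X i ⁻¹' {k})).toReal = betaBinPMF n a b k) :
    ∫ ω,
        ((1 / ((L : ℝ) - 1))
            * ∑ i, ((X i ω : ℝ) - (1 / (L : ℝ)) * ∑ j, (X j ω : ℝ)) ^ 2
          - (n : ℝ) * (((n : ℝ) / ((L : ℝ) * ((n : ℝ) - 1)))
              * ∑ i, ((X i ω : ℝ) / (n : ℝ)) * (1 - (X i ω : ℝ) / (n : ℝ))))
          / (n : ℝ) ^ 2 ∂P
      = a * b / ((a + b) ^ 2 * (a + b + 1)) := by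
  have hi1 : ∀ i, Integrable (fun ω => (X i ω : ℝ)) P := fun i =>
    integrable_of_dist P n a b (X i) (hX i) (hdist i) (fun k => (k : ℝ))
  have hi2 : ∀ i, Integrable (fun ω => (X i ω : ℝ) ^ 2) P := fun i =>
    integrable_of_dist P n a b (X i) (hX i) (hdist i) (fun k => (k : ℝ) ^ 2)
  obtain ⟨m1, hm1⟩ : ∃ m, m = (n : ℝ) * a / (a + b) := ⟨_, rfl⟩
  obtain ⟨m2, hm2⟩ : ∃ m, m = (n : ℝ) * (n - 1) * (a * (a + 1)) / ((a + b) * (a + b + 1))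
    + n * a / (a + b) := ⟨_, rfl⟩
  have hE1 : ∀ i, ∫ ω, (X i ω : ℝ) ∂P = m1 := fun i => by
    rw [integral_of_dist P n a b (X i) (hX i) (hdist i) (fun k => (k : ℝ)),
      pmf_moment_one n hn a b ha hb, hm1]
  have hE2 : ∀ i, ∫ ω, (X i ω : ℝ) ^ 2 ∂P = m2 := fun i => by
    rw [integral_of_dist P n a b (X i) (hX i) (hdist i) (fun k => (k : ℝ) ^ 2), hm2,
      ← pmf_moment_one n hn a b ha hb, ← pmf_moment_two n hn a b ha hb,
      ← Finset.sum_add_distrib]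
    exact Finset.sum_congr rfl fun k _ => by ring
  have hind : ∀ i j, i ≠ j →
      IndepFun (fun ω => (X i ω : ℝ)) (fun ω => (X j ω : ℝ)) P := fun i j hij =>
    (hindep.indepFun hij).comp (φ := fun k : ℕ => (k : ℝ)) (ψ := fun k : ℕ => (k : ℝ))
      (measurable_of_countable _) (measurable_of_countable _)
  have hi3 : ∀ i j, Integrable (fun ω => (X i ω : ℝ) * (X j ω : ℝ)) P := fun i j => by
    by_cases hij : i = j
    · subst hij
      simpa only [sq] using hi2 i
    · exact (hind i j hij).integrable_mul (hi1 i) (hi1 j)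
  have hE3 : ∀ i j, ∫ ω, (X i ω : ℝ) * (X j ω : ℝ) ∂P
      = m1 ^ 2 + if i = j then m2 - m1 ^ 2 else 0 := fun i j => by
    by_cases hij : i = j
    · subst hij
      simpa [sq] using hE2 i
    · rw [(hind i j hij).integral_fun_mul_eq_mul_integral (hi1 i).aestronglyMeasurable
        (hi1 j).aestronglyMeasurable, hE1, hE1, if_neg hij]
      ring
  have hI1 : Integrable (fun ω => ∑ i, (X i ω : ℝ)) P := integrable_finsetSum _ fun i _ => hi1 i
  have hI2 : Integrable (fun ω => ∑ i, (X i ω : ℝ) ^ 2) P :=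
    integrable_finsetSum _ fun i _ => hi2 i
  have hI3' : ∀ i, Integrable (fun ω => ∑ j, (X i ω : ℝ) * (X j ω : ℝ)) P := fun i =>
    integrable_finsetSum _ fun j _ => hi3 i j
  have hI3 : Integrable (fun ω => ∑ i, ∑ j, (X i ω : ℝ) * (X j ω : ℝ)) P :=
    integrable_finsetSum _ fun i _ => hI3' i
  have hS1 : ∫ ω, ∑ i, (X i ω : ℝ) ∂P = L * m1 := by
    rw [integral_finsetSum _ fun i _ => hi1 i]; simp [hE1]
  have hS2 : ∫ ω, ∑ i, (X i ω : ℝ) ^ 2 ∂P = L * m2 := by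
    rw [integral_finsetSum _ fun i _ => hi2 i]; simp [hE2]
  have hS3 : ∫ ω, ∑ i, ∑ j, (X i ω : ℝ) * (X j ω : ℝ) ∂P
      = L * (L * m1 ^ 2 + (m2 - m1 ^ 2)) := by
    rw [integral_finsetSum _ fun i _ => hI3' i]
    simp_rw [fun i => integral_finsetSum (μ := P) Finset.univ fun j _ => hi3 i j, hE3,
      Finset.sum_add_distrib]
    simp
    ring
  simp_rw [fun ω => integrand_eq L n hn hL (fun i => (X i ω : ℝ))]
  have hlin : ∀ c d e : ℝ, ∫ ω, (c * ∑ i, (X i ω : ℝ) ^ 2 - d * ∑ i, (X i ω : ℝ)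
      - e * ∑ i, ∑ j, (X i ω : ℝ) * (X j ω : ℝ)) ∂P
      = c * ∫ ω, ∑ i, (X i ω : ℝ) ^ 2 ∂P - d * ∫ ω, ∑ i, (X i ω : ℝ) ∂P
        - e * ∫ ω, ∑ i, ∑ j, (X i ω : ℝ) * (X j ω : ℝ) ∂P := fun c d e => by
    have h12 : Integrable (fun ω => c * ∑ i, (X i ω : ℝ) ^ 2 - d * ∑ i, (X i ω : ℝ)) P :=
      (hI2.const_mul c).sub (hI1.const_mul d)
    rw [integral_sub h12 (hI3.const_mul e),
      integral_sub (hI2.const_mul c) (hI1.const_mul d), integral_const_mul, integral_const_mul,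
      integral_const_mul]
  rw [hlin, hS1, hS2, hS3, hm1, hm2]
  have hn' : (2 : ℝ) ≤ n := by exact_mod_cast hn
  have hL' : (2 : ℝ) ≤ L := by exact_mod_cast hL
  have h1 : (n : ℝ) - 1 ≠ 0 := by linarith
  have h2 : (L : ℝ) - 1 ≠ 0 := by linarith
  have h3 : (n : ℝ) ≠ 0 := by linarith
  have h4 : (L : ℝ) ≠ 0 := by linarith
  have h5 : a + b ≠ 0 := by positivity
  have h6 : a + b + 1 ≠ 0 := by positivity
  field_simp
  ring
end

section
/- (Proposition 3, unbiasedness of the reproducibility variance estimate.) Let a, b > 0 be real numbers, let n ≥ 2 and L ≥ 2 be natural numbers, and let X₁,…,X_L be independent random variables each distributed according to the beta-binomial distribution BBi(n,a,b). With p̂ᵢ = Xᵢ/n, σ̂_r² = (n/(L(n−1)))·Σᵢ p̂ᵢ(1−p̂ᵢ), and σ̂_BBi² = (1/(L−1))·Σᵢ (Xᵢ − X̄)² where X̄ = (1/L)Σᵢ Xᵢ, the estimator σ̂_R² = (σ̂_BBi² + n(n−1)·σ̂_r²)/n² satisfies E[σ̂_R²] = a·b/(a+b)² = σ_R²; that is,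 σ̂_R² is an unbiased estimate of the reproducibility variance. -/
open MeasureTheory ProbabilityTheory

lemma bf_eq (a b : ℝ) (ha : 0 < a) (hb : 0 < b) : betaFun a b = ProbabilityTheory.beta a b := by
  rw [ProbabilityTheory.beta_eq_betaIntegralReal a b ha hb, Complex.betaIntegral, betaFun]
  have : ∀ t ∈ Set.uIcc (0:ℝ) 1, (t:ℂ) ^ ((a:ℂ) - 1) * (1 - (t:ℂ)) ^ ((b:ℂ) - 1)
      = ((t ^ (a - 1) * (1 - t) ^ (b - 1) : ℝ) : ℂ) := by
    intro t ht
    rw [Set.uIcc_of_le zero_le_one] at ht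
    have h1 : (0:ℝ) ≤ 1 - t := by linarith [ht.2]
    push_cast [Complex.ofReal_cpow ht.1, Complex.ofReal_cpow h1]
    rfl
  rw [intervalIntegral.integral_congr this, intervalIntegral.integral_ofReal, Complex.ofReal_re]

lemma bf_pos (a b : ℝ) (ha : 0 < a) (hb : 0 < b) : 0 < betaFun a b := by
  rw [bf_eq a b ha hb]; exact ProbabilityTheory.beta_pos ha hb

lemma bf_succ_left (a b : ℝ) (ha : 0 < a) (hb : 0 < b) :
    betaFun (a + 1) b = a / (a + b) * betaFun a b := by
  rw [bf_eq _ _ (by positivity) hb, bf_eq a b ha hb, ProbabilityTheory.beta, ProbabilityTheory.beta,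
    Real.Gamma_add_one ha.ne', show a + 1 + b = (a + b) + 1 by ring,
    Real.Gamma_add_one (by positivity)]
  have := (Real.Gamma_pos_of_pos (add_pos ha hb)).ne'
  field_simp

lemma bf_succ_right (a b : ℝ) (ha : 0 < a) (hb : 0 < b) :
    betaFun a (b + 1) = b / (a + b) * betaFun a b := by
  rw [bf_eq _ _ ha (by positivity), bf_eq a b ha hb, ProbabilityTheory.beta, ProbabilityTheory.beta,
    Real.Gamma_add_one hb.ne', ← add_assoc,
    Real.Gamma_add_one (by positivity)]
  have := (Real.Gamma_pos_of_pos (add_pos ha hb)).ne'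
  field_simp

lemma bf_sum (m : ℕ) : ∀ (a b : ℝ), 0 < a → 0 < b →
    ∑ ij ∈ Finset.HasAntidiagonal.antidiagonal m, (m.choose ij.1 : ℝ) * betaFun (ij.1 + a) (ij.2 + b)
      = betaFun a b := by
  induction m with
  | zero => intro a b _ _; simp
  | succ m ih =>
    intro a b ha hb
    rw [Finset.sum_antidiagonal_choose_succ_mul (fun i j => betaFun ((i:ℝ) + a) ((j:ℝ) + b)) m]
    have h1 := ih a (b + 1) ha (by positivity)
    have h2 := ih (a + 1) b (by positivity) hb
    rw [bf_succ_right a b ha hb] at h1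
    rw [bf_succ_left a b ha hb] at h2
    have e1 : ∀ ij ∈ Finset.HasAntidiagonal.antidiagonal m,
        (m.choose ij.1 : ℝ) * betaFun ((ij.1:ℝ) + a) (((ij.2 + 1 : ℕ):ℝ) + b)
        = (m.choose ij.1 : ℝ) * betaFun (ij.1 + a) (ij.2 + (b + 1)) := by
      intro ij _; congr 2; push_cast; ring
    have e2 : ∀ ij ∈ Finset.HasAntidiagonal.antidiagonal m,
        (m.choose ij.2 : ℝ) * betaFun (((ij.1 + 1 : ℕ):ℝ) + a) ((ij.2:ℝ) + b)
        = (m.choose ij.1 : ℝ) * betaFun (ij.1 + (a + 1)) (ij.2 + b) := by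
      intro ij h
      rw [Nat.choose_symm_of_eq_add (Finset.HasAntidiagonal.mem_antidiagonal.1 h).symm]
      congr 2; push_cast; ring
    rw [Finset.sum_congr rfl e1, Finset.sum_congr rfl e2, h1, h2]
    field_simp
    ring

lemma bb_mean (n : ℕ) (hn : 2 ≤ n) (a b : ℝ) (ha : 0 < a) (hb : 0 < b) :
    ∑ k ∈ Finset.range (n + 1), betaBinPMF n a b k * (k : ℝ) = n * a / (a + b) := by
  obtain ⟨m, rfl⟩ : ∃ m, n = m + 1 := ⟨n - 1, by omega⟩
  have hB := (bf_pos a b ha hb).ne'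
  rw [Finset.sum_range_succ']
  have h := bf_sum m (a + 1) b (by positivity) hb
  rw [Finset.Nat.sum_antidiagonal_eq_sum_range_succ_mk, bf_succ_left a b ha hb] at h
  have : ∀ k ∈ Finset.range (m + 1), betaBinPMF (m + 1) a b (k + 1) * ((k + 1 : ℕ) : ℝ)
      = ((m + 1 : ℕ) : ℝ) / betaFun a b *
        ((m.choose k : ℝ) * betaFun ((k:ℝ) + (a + 1)) (((m - k : ℕ) : ℝ) + b)) := by
    intro k hk
    have hk' : k ≤ m := by simpa [Nat.lt_succ_iff] using hk
    have hc : ((m + 1 : ℕ) : ℝ) * (m.choose k : ℝ)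
        = ((m + 1).choose (k + 1) : ℝ) * ((k + 1 : ℕ) : ℝ) := by
      exact_mod_cast Nat.add_one_mul_choose_eq m k
    unfold betaBinPMF
    rw [show (((k + 1 : ℕ) : ℝ) + a) = (k:ℝ) + (a + 1) by push_cast; ring,
      show (((m + 1 : ℕ) : ℝ) - ((k + 1 : ℕ) : ℝ) + b) = ((m - k : ℕ) : ℝ) + b by
        push_cast [Nat.cast_sub hk']; ring]
    generalize betaFun ((k:ℝ) + (a + 1)) (((m - k : ℕ) : ℝ) + b) = z
    linear_combination (-z / betaFun a b) * hc
  rw [Finset.sum_congr rfl this, ← Finset.mul_sum, h]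
  field_simp
  simp

theorem reproducibility_estimate_unbiased {Ω : Type*} [MeasurableSpace Ω]
    (P : Measure Ω) [IsProbabilityMeasure P]
    (a b : ℝ) (ha : 0 < a) (hb : 0 < b)
    (n : ℕ) (hn : 2 ≤ n) (L : ℕ) (hL : 2 ≤ L)
    (X : Fin L → Ω → ℕ) (hX : ∀ i, Measurable (X i))
    (hindep : iIndepFun X P)
    (hdist : ∀ i, ∀ k : ℕ, (P (X i ⁻¹' {k})).toReal = betaBinPMF n a b k) :
    ∫ ω,
        ((1 / ((L : ℝ) - 1))
            * ∑ i, ((X i ω : ℝ) - (1 / (L : ℝ)) * ∑ j, (X j ω : ℝ)) ^ 2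
          + (n : ℝ) * ((n : ℝ) - 1) * (((n : ℝ) / ((L : ℝ) * ((n : ℝ) - 1)))
              * ∑ i, ((X i ω : ℝ) / (n : ℝ)) * (1 - (X i ω : ℝ) / (n : ℝ))))
          / (n : ℝ) ^ 2 ∂P
      = a * b / (a + b) ^ 2 := by
  have hn' : (2:ℝ) ≤ n := by exact_mod_cast hn
  have hL' : (2:ℝ) ≤ L := by exact_mod_cast hL
  have hzero : ∀ i k, n < k → P (X i ⁻¹' {k}) = 0 := by
    intro i k hk
    have h := hdist i k
    rw [betaBinPMF, Nat.choose_eq_zero_of_lt hk] at h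
    simp only [Nat.cast_zero, zero_mul, zero_div] at h
    exact (ENNReal.toReal_eq_zero_iff _).1 h |>.resolve_right (measure_ne_top _ _)
  have hle : ∀ i, ∀ᵐ ω ∂P, X i ω ≤ n := by
    intro i
    have : ∀ᵐ ω ∂P, ∀ k, n < k → X i ω ≠ k := by
      rw [ae_all_iff]; intro k
      by_cases hk : n < k
      · have := hzero i k hk
        rw [← compl_compl (X i ⁻¹' {k})] at this
        filter_upwards [mem_ae_iff.2 this] with ω hω _ h
        exact hω h
      · exact Filter.Eventually.of_forall fun ω h => absurd h hk
    filter_upwards [this] with ω hω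
    by_contra h
    exact hω (X i ω) (by omega) rfl
  have hmeas : ∀ i, Measurable (fun ω => (X i ω : ℝ)) := fun i =>
    (measurable_from_top (f := fun k : ℕ => (k:ℝ))).comp (hX i)
  have hLp : ∀ i, MemLp (fun ω => (X i ω : ℝ)) 2 P := by
    intro i
    refine MemLp.of_bound (hmeas i).aestronglyMeasurable n ?_
    filter_upwards [hle i] with ω hω
    simpa using hω
  have hint : ∀ i, Integrable (fun ω => (X i ω : ℝ)) P := fun i =>
    (hLp i).integrable (by norm_num)
  have hint2 : ∀ i, Integrable (fun ω => (X i ω : ℝ) ^ 2) P := fun i => (hLp i).integrable_sq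
  have hmean : ∀ i, ∫ ω, (X i ω : ℝ) ∂P = n * a / (a + b) := by
    intro i
    have hae : AEStronglyMeasurable (fun k : ℕ => (k:ℝ)) (P.map (X i)) :=
      (measurable_from_top).aestronglyMeasurable
    rw [← integral_map (f := fun k : ℕ => (k:ℝ)) (hX i).aemeasurable hae,
      integral_countable ((integrable_map_measure hae (hX i).aemeasurable).2 (hint i)),
      ← bb_mean n hn a b ha hb, tsum_eq_sum (s := Finset.range (n + 1))]
    · refine Finset.sum_congr rfl fun k _ => ?_
      rw [measureReal_def, Measure.map_apply (hX i) (measurableSet_singleton k), hdist, smul_eq_mul]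
    · intro k hk
      rw [measureReal_def, Measure.map_apply (hX i) (measurableSet_singleton k),
        hzero i k (by simpa using hk)]
      simp
  set μ : ℝ := n * a / (a + b) with hμ
  have hS : MemLp (fun ω => ∑ i, (X i ω : ℝ)) 2 P := memLp_finsetSum _ fun i _ => hLp i
  have hSmean : ∫ ω, ∑ i, (X i ω : ℝ) ∂P = L * μ := by
    rw [integral_finsetSum _ fun i _ => hint i]; simp [hmean]
  have hvar := IndepFun.variance_sum (μ := P) (X := fun i ω => (X i ω : ℝ)) (s := Finset.univ)
    (fun i _ => hLp i) (fun i _ j _ hij => (hindep.indepFun hij).comp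
      (φ := fun k : ℕ => (k:ℝ)) (ψ := fun k : ℕ => (k:ℝ)) measurable_from_top measurable_from_top)
  have hS2 : ∫ ω, (∑ i, (X i ω : ℝ)) ^ 2 ∂P
      = ∑ i, ∫ ω, (X i ω : ℝ) ^ 2 ∂P - L * μ ^ 2 + (L * μ) ^ 2 := by
    have e : (∑ i, fun ω => (X i ω : ℝ)) = fun ω => ∑ i, (X i ω : ℝ) := by
      ext ω; simp
    rw [e, variance_eq_sub hS, Finset.sum_congr rfl fun i _ => variance_eq_sub (hLp i)] at hvar
    simp only [Pi.pow_apply, hSmean, hmean, Finset.sum_sub_distrib, Finset.sum_const,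
      Finset.card_univ, Fintype.card_fin, nsmul_eq_mul] at hvar
    linarith
  have hrew : ∀ ω, ((1 / ((L : ℝ) - 1))
            * ∑ i, ((X i ω : ℝ) - (1 / (L : ℝ)) * ∑ j, (X j ω : ℝ)) ^ 2
          + (n : ℝ) * ((n : ℝ) - 1) * (((n : ℝ) / ((L : ℝ) * ((n : ℝ) - 1)))
              * ∑ i, ((X i ω : ℝ) / (n : ℝ)) * (1 - (X i ω : ℝ) / (n : ℝ))))
          / (n : ℝ) ^ 2
      = (1 / (L * (L - 1)) / (n:ℝ)^2) * (∑ i, (X i ω : ℝ) ^ 2)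
        + (1 / L / n) * (∑ i, (X i ω : ℝ))
        - (1 / (L * (L - 1)) / (n:ℝ)^2) * (∑ i, (X i ω : ℝ)) ^ 2 := by
    intro ω
    have e1 : ∑ i, ((X i ω : ℝ) - (1 / (L : ℝ)) * ∑ j, (X j ω : ℝ)) ^ 2
        = ∑ i, (X i ω : ℝ) ^ 2 - (1 / L) * (∑ i, (X i ω : ℝ)) ^ 2 := by
      simp only [sub_sq, Finset.sum_add_distrib, Finset.sum_sub_distrib, ← Finset.sum_mul,
        ← Finset.mul_sum, Finset.sum_const, Finset.card_univ, Fintype.card_fin, nsmul_eq_mul]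
      field_simp
      ring
    have e2 : ∑ i, ((X i ω : ℝ) / (n : ℝ)) * (1 - (X i ω : ℝ) / (n : ℝ))
        = (1 / n) * (∑ i, (X i ω : ℝ)) - (1 / (n:ℝ)^2) * ∑ i, (X i ω : ℝ) ^ 2 := by
      rw [Finset.mul_sum, Finset.mul_sum, ← Finset.sum_sub_distrib]
      refine Finset.sum_congr rfl fun i _ => ?_
      field_simp
    rw [e1, e2]
    have h1 : (L:ℝ) - 1 ≠ 0 := by linarith
    have h2 : (n:ℝ) - 1 ≠ 0 := by linarith
    field_simp
    ring
  simp_rw [hrew]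
  have i1 : Integrable (fun ω => ∑ i, (X i ω : ℝ) ^ 2) P := integrable_finsetSum _ fun i _ => hint2 i
  have i2 : Integrable (fun ω => ∑ i, (X i ω : ℝ)) P := integrable_finsetSum _ fun i _ => hint i
  have i3 : Integrable (fun ω => (1 / (L * (L - 1)) / (n:ℝ)^2) * (∑ i, (X i ω : ℝ) ^ 2)
        + (1 / L / n) * (∑ i, (X i ω : ℝ))) P := (i1.const_mul _).add (i2.const_mul _)
  rw [integral_sub i3 (hS.integrable_sq.const_mul _),
    integral_add (i1.const_mul _) (i2.const_mul _), integral_const_mul, integral_const_mul,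
    integral_const_mul, hSmean, hS2, integral_finsetSum _ fun i _ => hint2 i]
  have h1 : (L:ℝ) - 1 ≠ 0 := by linarith
  rw [hμ]
  field_simp
  ring
end
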